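/- Assume the families (G,B) and G satisfy positivity, and that (i) Y ⊥⊥ B_p | G_p ∪ {A_p} and (ii) G_k ⊥⊥ B_{k−1} | G_{k−1} ∪ {A_{k−1}} for every k = 1,…,p. Then for every k = 0,…,p the iterated regressions coincide: b_{a_k}((G,B)) = b_{a_k}(G) almost surely; in particular E[b_{a_0}((G,B))] = E[b_{a_0}(G)]. (Equation (11) in the proof of Lemma 4.2, proved by reverse induction; it yields that G identifies the same functional as (G,B).) -/

import Mathlib

open MeasureTheory ProbabilityTheory

noncomputable section

/-- The σ-algebra generated by a set of real-valued random variables. -/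
def genSig {Ω : Type*} (S : Set (Ω → ℝ)) : MeasurableSpace Ω :=
  ⨆ f ∈ S, MeasurableSpace.comap f (inferInstance : MeasurableSpace ℝ)

/-- Indicator `1_{A = a}` of the event that the random variable `A` takes the value `a`. -/
def ind {Ω : Type*} (A : Ω → ℝ) (a : ℝ) : Ω → ℝ := fun ω => if A ω = a then 1 else 0

/-- `I_{ā_{k-1}}(Ā_{k-1}) = ∏_{j<k} 1_{A_j = a_j}` (equal to `1` when `k = 0`). -/
def indUpto {Ω : Type*} (A : ℕ → Ω → ℝ) (a : ℕ → ℝ) (k : ℕ) : Ω → ℝ :=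
  fun ω => ∏ j ∈ Finset.range k, ind (A j) (a j) ω

variable {Ω : Type*} [MeasurableSpace Ω]

/-- Propensity `π_{a_k}(Z_k) = E[1_{A_k = a_k} ∣ σ(Z_k)]`. -/
def propen (μ : Measure Ω) (A : ℕ → Ω → ℝ) (a : ℕ → ℝ) (Z : ℕ → Set (Ω → ℝ)) (k : ℕ) : Ω → ℝ :=
  μ[ind (A k) (a k) | genSig (Z k)]

/-- Cumulative weight `λ_{ā_{k-1}}(Z̄_{k-1}) = ∏_{j<k} π_{a_j}(Z_j)` (equal to `1` when `k = 0`). -/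
def cumWeight (μ : Measure Ω) (A : ℕ → Ω → ℝ) (a : ℕ → ℝ) (Z : ℕ → Set (Ω → ℝ)) (k : ℕ) :
    Ω → ℝ :=
  fun ω => ∏ j ∈ Finset.range k, propen μ A a Z j ω

/-- The adjustment family `Z` satisfies positivity: the propensities are uniformly bounded away
from `0` almost surely, for every time `k = 0, …, p`. -/
def Positivity (μ : Measure Ω) (A : ℕ → Ω → ℝ) (a : ℕ → ℝ) (Z : ℕ → Set (Ω → ℝ)) (p : ℕ) :
    Prop :=
  ∃ c : ℝ, 0 < c ∧ ∀ k ≤ p, ∀ᵐ ω ∂μ, c ≤ propen μ A a Z k ω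

/-- Auxiliary downward recursion: `bAux μ A a Y Z p n` is the iterated regression
`b_{a_{p-n}}(Z)`. -/
def bAux (μ : Measure Ω) (A : ℕ → Ω → ℝ) (a : ℕ → ℝ) (Y : Ω → ℝ) (Z : ℕ → Set (Ω → ℝ))
    (p : ℕ) : ℕ → Ω → ℝ
  | 0 => fun ω =>
      (μ[fun ω' => Y ω' * ind (A p) (a p) ω' | genSig (Z p)]) ω / propen μ A a Z p ω
  | n + 1 => fun ω =>
      (μ[fun ω' => bAux μ A a Y Z p n ω' * ind (A (p - (n + 1))) (a (p - (n + 1))) ω' |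
          genSig (Z (p - (n + 1)))]) ω / propen μ A a Z (p - (n + 1)) ω

/-- Iterated regression `b_{a_k}(Z)`, for `k = 0, …, p`. -/
def breg (μ : Measure Ω) (A : ℕ → Ω → ℝ) (a : ℕ → ℝ) (Y : Ω → ℝ) (Z : ℕ → Set (Ω → ℝ))
    (p k : ℕ) : Ω → ℝ :=
  bAux μ A a Y Z p (p - k)

/-- `b_{a_{k-1}}(Z)` with the convention `b_{a_{-1}}(Z) = E[b_{a_0}(Z)]` (a constant). -/
def bregPrev (μ : Measure Ω) (A : ℕ → Ω → ℝ) (a : ℕ → ℝ) (Y : Ω → ℝ) (Z : ℕ → Set (Ω → ℝ))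
    (p k : ℕ) : Ω → ℝ :=
  if k = 0 then fun _ => ∫ ω, breg μ A a Y Z p 0 ω ∂μ else breg μ A a Y Z p (k - 1)

/-- The influence function `ψ_a(Z)`. -/
def psi (μ : Measure Ω) (A : ℕ → Ω → ℝ) (a : ℕ → ℝ) (Y : Ω → ℝ) (Z : ℕ → Set (Ω → ℝ))
    (p : ℕ) : Ω → ℝ := fun ω =>
  indUpto A a (p + 1) ω * (Y ω - breg μ A a Y Z p p ω) / cumWeight μ A a Z (p + 1) ω +
    ∑ k ∈ Finset.range (p + 1),
      indUpto A a k ω * (breg μ A a Y Z p k ω - bregPrev μ A a Y Z p k ω) /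
        cumWeight μ A a Z k ω

end

section CondExpHelpers

variable {Ω : Type*} {mΩ : MeasurableSpace Ω} {P : Measure Ω}

theorem isPiSystem_inter_measurableSet (m₁ m₂ : MeasurableSpace Ω) :
    IsPiSystem {u | ∃ s t, MeasurableSet[m₁] s ∧ MeasurableSet[m₂] t ∧ u = s ∩ t} := by
  rintro _ ⟨s, t, hs, ht, rfl⟩ _ ⟨s', t', hs', ht', rfl⟩ -
  exact ⟨s ∩ s', t ∩ t', hs.inter hs', ht.inter ht', Set.inter_inter_inter_comm _ _ _ _⟩

theorem sup_eq_generateFrom_inter (m₁ m₂ : MeasurableSpace Ω) :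
    m₁ ⊔ m₂ = MeasurableSpace.generateFrom
      {u | ∃ s t, MeasurableSet[m₁] s ∧ MeasurableSet[m₂] t ∧ u = s ∩ t} := by
  apply le_antisymm
  · refine sup_le (fun s hs => ?_) (fun t ht => ?_)
    · exact MeasurableSpace.measurableSet_generateFrom
        ⟨s, Set.univ, hs, @MeasurableSet.univ _ m₂, by simp⟩
    · exact MeasurableSpace.measurableSet_generateFrom
        ⟨Set.univ, t, @MeasurableSet.univ _ m₁, ht, by simp⟩
  · refine MeasurableSpace.generateFrom_le ?_
    rintro _ ⟨s, t, hs, ht, rfl⟩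
    exact MeasurableSet.inter (le_sup_left (a := m₁) (b := m₂) _ hs)
      (le_sup_right (a := m₁) (b := m₂) _ ht)

/-- To identify a conditional expectation given `m₁ ⊔ m₂` it is enough to test on
intersections of an `m₁`-measurable set and an `m₂`-measurable set. -/
theorem ae_eq_condExp_sup [IsFiniteMeasure P] {m₁ m₂ : MeasurableSpace Ω}
    (h₁ : m₁ ≤ mΩ) (h₂ : m₂ ≤ mΩ) {f g : Ω → ℝ} (hf : Integrable f P) (hg : Integrable g P)
    (hgm : StronglyMeasurable[m₁ ⊔ m₂] g)
    (h : ∀ s t, MeasurableSet[m₁] s → MeasurableSet[m₂] t →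
      ∫ x in s ∩ t, g x ∂P = ∫ x in s ∩ t, f x ∂P) :
    g =ᵐ[P] P[f | m₁ ⊔ m₂] := by
  have hle : m₁ ⊔ m₂ ≤ mΩ := sup_le h₁ h₂
  have huniv : ∫ x, g x ∂P = ∫ x, f x ∂P := by
    simpa using h Set.univ Set.univ (@MeasurableSet.univ _ m₁) (@MeasurableSet.univ _ m₂)
  refine ae_eq_condExp_of_forall_setIntegral_eq hle hf (fun _ _ _ => hg.integrableOn) ?_
    hgm.aestronglyMeasurable
  intro s hs _
  induction s, hs using MeasurableSpace.induction_on_inter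
    (sup_eq_generateFrom_inter m₁ m₂) (isPiSystem_inter_measurableSet m₁ m₂) with
  | empty => simp
  | basic u hu =>
    obtain ⟨s, t, hs, ht, rfl⟩ := hu
    exact h s t hs ht
  | compl u hu ih =>
    rw [setIntegral_compl (hle _ hu) hg, setIntegral_compl (hle _ hu) hf, huniv,
      ih (measure_lt_top _ _)]
  | iUnion u hd hu ih =>
    rw [integral_iUnion (fun i => hle _ (hu i)) hd hg.integrableOn,
      integral_iUnion (fun i => hle _ (hu i)) hd hf.integrableOn]
    exact tsum_congr fun i => ih i (measure_lt_top _ _)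

/-- If, given `m`, the function `f` is conditionally uncorrelated with every `m₂`-measurable set,
then its conditional expectations given `m` and given `m ⊔ m₂` agree. -/
theorem condExp_sup_eq_of_condExp_mul_indicator [IsFiniteMeasure P] {m m₂ : MeasurableSpace Ω}
    (hm : m ≤ mΩ) (h₂ : m₂ ≤ mΩ) {f : Ω → ℝ} (hf : Integrable f P)
    (h : ∀ t, MeasurableSet[m₂] t → P[t.indicator f | m] =ᵐ[P] P[f | m] * P⟦t | m⟧) :
    P[f | m] =ᵐ[P] P[f | m ⊔ m₂] := by
  refine ae_eq_condExp_sup hm h₂ hf integrable_condExp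
    (stronglyMeasurable_condExp.mono le_sup_left) fun s t hs ht => ?_
  have ht' := h₂ _ ht
  have hind : t.indicator (P[f | m]) = P[f | m] * t.indicator (fun _ => (1 : ℝ)) := by
    ext x; by_cases hx : x ∈ t <;> simp [hx]
  have hpull : P[t.indicator (P[f | m]) | m] =ᵐ[P] P[f | m] * P⟦t | m⟧ := by
    rw [hind]
    refine condExp_mul_of_stronglyMeasurable_left stronglyMeasurable_condExp ?_
      ((integrable_const 1).indicator ht')
    rw [← hind]
    exact integrable_condExp.indicator ht'
  calc ∫ x in s ∩ t, (P[f | m]) x ∂P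
      = ∫ x in s, t.indicator (P[f | m]) x ∂P := (setIntegral_indicator ht').symm
    _ = ∫ x in s, (P[t.indicator (P[f | m]) | m]) x ∂P :=
        (setIntegral_condExp hm (integrable_condExp.indicator ht') hs).symm
    _ = ∫ x in s, (P[t.indicator f | m]) x ∂P :=
        integral_congr_ae (ae_restrict_of_ae (hpull.trans (h t ht).symm))
    _ = ∫ x in s, t.indicator f x ∂P := setIntegral_condExp hm (hf.indicator ht') hs
    _ = ∫ x in s ∩ t, f x ∂P := setIntegral_indicator ht'

theorem condExp_indicator_one_sup_of_condIndep [StandardBorelSpace Ω] [IsFiniteMeasure P]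
    {m m₁ m₂ : MeasurableSpace Ω} (hm : m ≤ mΩ) (h₁ : m₁ ≤ mΩ) (h₂ : m₂ ≤ mΩ)
    (hci : CondIndep m m₁ m₂ hm P) {u : Set Ω} (hu : MeasurableSet[m₂] u) :
    P⟦u | m⟧ =ᵐ[P] P⟦u | m ⊔ m₁⟧ := by
  refine condExp_sup_eq_of_condExp_mul_indicator hm h₁
    ((integrable_const 1).indicator (h₂ _ hu)) fun t ht => ?_
  have := (condIndep_iff m m₁ m₂ hm h₁ h₂ P).1 hci t u ht hu
  rw [Set.indicator_indicator]
  filter_upwards [this] with x hx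
  rw [hx, Pi.mul_apply, Pi.mul_apply, mul_comm]

/-- If `m₁` and `m₂` are conditionally independent given `m`, then adding `m₂` to `m` does not
change the conditional expectation of an `m₁`-measurable function. -/
theorem condExp_sup_of_condIndep [StandardBorelSpace Ω] [IsFiniteMeasure P]
    {m m₁ m₂ : MeasurableSpace Ω} (hm : m ≤ mΩ) (h₁ : m₁ ≤ mΩ) (h₂ : m₂ ≤ mΩ)
    (hci : CondIndep m m₁ m₂ hm P) {f : Ω → ℝ} (hfm : StronglyMeasurable[m₁] f)
    (hf : Integrable f P) :
    P[f | m] =ᵐ[P] P[f | m ⊔ m₂] := by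
  refine condExp_sup_eq_of_condExp_mul_indicator hm h₂ hf fun t ht => ?_
  have ht' := h₂ _ ht
  have hone : Integrable (t.indicator fun _ => (1 : ℝ)) P := (integrable_const 1).indicator ht'
  have hind : t.indicator f = f * t.indicator (fun _ => (1 : ℝ)) := by
    ext x; by_cases hx : x ∈ t <;> simp [hx]
  have hint : Integrable (f * t.indicator (fun _ => (1 : ℝ))) P := hind ▸ hf.indicator ht'
  have hstep : P[t.indicator f | m ⊔ m₁] =ᵐ[P] f * P⟦t | m⟧ := by
    rw [hind]
    refine (condExp_mul_of_stronglyMeasurable_left (hfm.mono (le_sup_right : m₁ ≤ m ⊔ m₁)) hint hone).trans ?_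
    filter_upwards [condExp_indicator_one_sup_of_condIndep hm h₁ h₂ hci ht] with x hx
    rw [Pi.mul_apply, Pi.mul_apply, hx]
  have hle : m ⊔ m₁ ≤ mΩ := sup_le hm h₁
  calc P[t.indicator f | m]
      =ᵐ[P] P[P[t.indicator f | m ⊔ m₁] | m] := (condExp_condExp_of_le le_sup_left hle).symm
    _ =ᵐ[P] P[f * P⟦t | m⟧ | m] := condExp_congr_ae hstep
    _ =ᵐ[P] P[f | m] * P⟦t | m⟧ :=
        condExp_mul_of_stronglyMeasurable_right stronglyMeasurable_condExp
          (integrable_condExp.congr hstep) hf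

/-- On a level set of `A`, a function measurable for `m ⊔ σ(A)` agrees with an `m`-measurable
one. -/
theorem exists_measurable_eq_on_preimage {m : MeasurableSpace Ω} {A : Ω → ℝ} (a : ℝ)
    {h : Ω → ℝ} (hh : Measurable[m ⊔ MeasurableSpace.comap A inferInstance] h) :
    ∃ g : Ω → ℝ, Measurable[m] g ∧ ∀ ω, A ω = a → h ω = g ω := by
  let v : {ω // A ω = a} → Ω := Subtype.val
  have hcomap : (m ⊔ MeasurableSpace.comap A inferInstance).comap v = m.comap v := by
    have hconst : A ∘ v = fun _ => a := funext fun x => x.2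
    rw [MeasurableSpace.comap_sup, MeasurableSpace.comap_comp, hconst,
      MeasurableSpace.comap_const, sup_bot_eq]
  have hv : Measurable[m.comap v] (h ∘ v) := by
    rw [← hcomap]
    exact hh.comp (comap_measurable v)
  obtain ⟨g, hg, hgeq⟩ := hv.exists_eq_measurable_comp
  exact ⟨g, hg, fun ω hω => congrFun hgeq ⟨ω, hω⟩⟩

theorem measurable_ind {A : Ω → ℝ} (hA : Measurable A) (a : ℝ) : Measurable (ind A a) :=
  Measurable.ite (hA (measurableSet_singleton a)) measurable_const measurable_const

theorem abs_ind_le_one (A : Ω → ℝ) (a : ℝ) (ω : Ω) : |ind A a ω| ≤ 1 := by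
  unfold ind; split_ifs <;> simp

theorem integrable_ind [IsFiniteMeasure P] {A : Ω → ℝ} (hA : Measurable A) (a : ℝ) :
    Integrable (ind A a) P :=
  Integrable.of_bound (measurable_ind hA a).aestronglyMeasurable 1
    (ae_of_all _ (abs_ind_le_one A a))

theorem integrable_mul_ind {A : Ω → ℝ} (hA : Measurable A) (a : ℝ) {f : Ω → ℝ}
    (hf : Integrable f P) : Integrable (f * ind A a) P :=
  hf.mul_bdd (c := 1) (measurable_ind hA a).aestronglyMeasurable
    (ae_of_all _ (abs_ind_le_one A a))

/-- The regression of `f` on `{A = a}` given `m ⊔ m₂` agrees with the one given `m`, when `f` is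
conditionally independent of `m₂` given `m ⊔ σ(A)`. -/
theorem condExp_mul_ind_div_eq_of_condIndep [StandardBorelSpace Ω] [IsFiniteMeasure P]
    {A : Ω → ℝ} (hA : Measurable A) (a : ℝ)
    {m m₁ m₂ : MeasurableSpace Ω} (h₁ : m₁ ≤ mΩ) (h₂ : m₂ ≤ mΩ)
    (hmA : m ⊔ MeasurableSpace.comap A inferInstance ≤ mΩ)
    (hci : CondIndep (m ⊔ MeasurableSpace.comap A inferInstance) m₁ m₂ hmA P)
    {f : Ω → ℝ} (hfm : StronglyMeasurable[m₁] f) (hf : Integrable f P)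
    (hpos : ∀ᵐ ω ∂P, (P[ind A a | m]) ω ≠ 0)
    (hpos₂ : ∀ᵐ ω ∂P, (P[ind A a | m ⊔ m₂]) ω ≠ 0) :
    (fun ω => (P[f * ind A a | m ⊔ m₂]) ω / (P[ind A a | m ⊔ m₂]) ω) =ᵐ[P]
      fun ω => (P[f * ind A a | m]) ω / (P[ind A a | m]) ω := by
  set mA := m ⊔ MeasurableSpace.comap A inferInstance with hmA_def
  have hindm : StronglyMeasurable[mA] (ind A a) :=
    (@measurable_ind Ω mA A ((comap_measurable A).mono le_sup_right le_rfl) a).stronglyMeasurable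
  obtain ⟨g, hg, hgeq⟩ := exists_measurable_eq_on_preimage a
    (stronglyMeasurable_condExp (μ := P) (f := f) (m := mA)).measurable
  have hgind : P[f | mA] * ind A a = g * ind A a := by
    ext ω
    by_cases hω : A ω = a
    · rw [Pi.mul_apply, Pi.mul_apply, hgeq ω hω]
    · simp [ind, hω]
  have hgint : Integrable (g * ind A a) P := hgind ▸ integrable_mul_ind hA a integrable_condExp
  have hfA := integrable_mul_ind hA a hf
  have hbase : P[f * ind A a | mA] =ᵐ[P] g * ind A a := by
    rw [← hgind]
    exact condExp_mul_of_stronglyMeasurable_right hindm hfA hf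
  have hsup : P[f * ind A a | mA ⊔ m₂] =ᵐ[P] g * ind A a := by
    refine (condExp_mul_of_stronglyMeasurable_right (hindm.mono (le_sup_left : mA ≤ mA ⊔ m₂)) hfA hf).trans ?_
    rw [← hgind]
    filter_upwards [condExp_sup_of_condIndep hmA h₁ h₂ hci hfm hf] with ω hω
    rw [Pi.mul_apply, Pi.mul_apply, hω]
  have key : ∀ {m' m'' : MeasurableSpace Ω}, m ≤ m' → m' ≤ m'' → m'' ≤ mΩ →
      P[f * ind A a | m''] =ᵐ[P] g * ind A a →
      P[f * ind A a | m'] =ᵐ[P] g * P[ind A a | m'] := fun {m' m''} h h' h'' he =>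
    calc P[f * ind A a | m']
        =ᵐ[P] P[P[f * ind A a | m''] | m'] := (condExp_condExp_of_le h' h'').symm
      _ =ᵐ[P] P[g * ind A a | m'] := condExp_congr_ae he
      _ =ᵐ[P] g * P[ind A a | m'] := condExp_mul_of_stronglyMeasurable_left
          (hg.mono h le_rfl).stronglyMeasurable hgint (integrable_ind hA a)
  have e₁ := key le_rfl le_sup_left hmA hbase
  have e₂ := key (m' := m ⊔ m₂) le_sup_left (sup_le_sup_right le_sup_left m₂)
    (sup_le hmA h₂) hsup
  filter_upwards [e₁, e₂, hpos, hpos₂] with ω h1 h2 h3 h4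
  rw [h1, h2, Pi.mul_apply, Pi.mul_apply, mul_div_cancel_right₀ _ h3,
    mul_div_cancel_right₀ _ h4]

theorem integrable_condExp_div {m : MeasurableSpace Ω} {f q : Ω → ℝ} {c : ℝ} (hm : m ≤ mΩ)
    (hq : StronglyMeasurable[m] q) (hc : 0 < c) (hcq : ∀ᵐ ω ∂P, c ≤ q ω) :
    Integrable (fun ω => (P[f | m]) ω / q ω) P := by
  simp_rw [div_eq_mul_inv]
  refine integrable_condExp.mul_bdd (c := c⁻¹)
    (hq.mono hm).measurable.inv.aestronglyMeasurable ?_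
  filter_upwards [hcq] with ω hω
  rw [norm_inv, Real.norm_of_nonneg (hc.le.trans hω)]
  exact inv_anti₀ hc hω

end CondExpHelpers

section GenSig

variable {Ω : Type*}

theorem genSig_union (S T : Set (Ω → ℝ)) : genSig (S ∪ T) = genSig S ⊔ genSig T :=
  iSup_union

theorem genSig_singleton (f : Ω → ℝ) :
    genSig {f} = MeasurableSpace.comap f inferInstance :=
  iSup_singleton

end GenSig

section IteratedRegression

variable {Ω : Type*} [mΩ : MeasurableSpace Ω] {P : Measure Ω}
  {A : ℕ → Ω → ℝ} {a : ℕ → ℝ} {Y : Ω → ℝ} {Z : ℕ → Set (Ω → ℝ)} {p : ℕ}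

theorem stronglyMeasurable_bAux (n : ℕ) :
    StronglyMeasurable[genSig (Z (p - n))] (bAux P A a Y Z p n) := by
  cases n <;> exact (stronglyMeasurable_condExp.measurable.div
    stronglyMeasurable_condExp.measurable).stronglyMeasurable

theorem integrable_bAux (hZ : ∀ k, genSig (Z k) ≤ mΩ) (hpos : Positivity P A a Z p) (n : ℕ) :
    Integrable (bAux P A a Y Z p n) P := by
  obtain ⟨c, hc, h⟩ := hpos
  cases n with
  | zero => exact integrable_condExp_div (hZ p) stronglyMeasurable_condExp hc (h p le_rfl)
  | succ n =>
    exact integrable_condExp_div (hZ _) stronglyMeasurable_condExp hc (h _ (Nat.sub_le _ _))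

theorem Positivity.propen_ne_zero (hpos : Positivity P A a Z p) {k : ℕ} (hk : k ≤ p) :
    ∀ᵐ ω ∂P, propen P A a Z k ω ≠ 0 := by
  obtain ⟨c, hc, h⟩ := hpos
  filter_upwards [h k hk] with ω hω
  exact (hc.trans_le hω).ne'

end IteratedRegression

/-- equation (11) in the proof of Lemma 4.2.  If the families `(G, B)` and
`G` satisfy positivity, `Y ⊥⊥ B_p ∣ G_p ∪ {A_p}` and `G_k ⊥⊥ B_(k-1) ∣ G_(k-1) ∪ {A_(k-1)}`
for `k = 1, …, p`, then `b_(a_k)((G, B)) = b_(a_k)(G)` a.s. for every `k = 0, …, p`; in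
particular `E[b_(a_0)((G, B))] = E[b_(a_0)(G)]`. -/
theorem breg_union_eq_breg {Ω : Type*} [mΩ : MeasurableSpace Ω] [StandardBorelSpace Ω]
    (P : Measure Ω) [IsProbabilityMeasure P] (p : ℕ)
    (A : ℕ → Ω → ℝ) (hA : ∀ k, Measurable (A k))
    (hAfin : ∀ k, (Set.range (A k)).Finite)
    (Y : Ω → ℝ) (hYm : Measurable Y) (hYbd : ∃ C : ℝ, ∀ ω, |Y ω| ≤ C)
    (a : ℕ → ℝ) (ha : ∀ k ≤ p, a k ∈ Set.range (A k))
    (K G B : ℕ → Set (Ω → ℝ)) (hKfin : ∀ k, (K k).Finite)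
    (hGle : ∀ k, genSig (G k) ≤ mΩ) (hBle : ∀ k, genSig (B k) ≤ mΩ)
    (hdisj : ∀ k ≤ p, Disjoint (G k) (B k))
    (hcover : ∀ k ≤ p, G k ∪ B k = A '' Set.Iio k ∪ ⋃ j ∈ Set.Iic k, K j)
    (hGAle : ∀ k, genSig (G k ∪ {A k}) ≤ mΩ)
    (hGBpos : Positivity P A a (fun k => G k ∪ B k) p)
    (hGpos : Positivity P A a G p)
    (hYB : CondIndep (genSig (G p ∪ {A p})) (MeasurableSpace.comap Y inferInstance)
      (genSig (B p)) (hGAle p) P)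
    (hGBk : ∀ k, 1 ≤ k → k ≤ p →
      CondIndep (genSig (G (k - 1) ∪ {A (k - 1)})) (genSig (G k)) (genSig (B (k - 1)))
        (hGAle (k - 1)) P) :
    (∀ k ≤ p, breg P A a Y (fun i => G i ∪ B i) p k =ᵐ[P] breg P A a Y G p k) ∧
    ∫ ω, breg P A a Y (fun i => G i ∪ B i) p 0 ω ∂P = ∫ ω, breg P A a Y G p 0 ω ∂P := by
  have hstep : ∀ k ≤ p, ∀ (m₁ : MeasurableSpace Ω), m₁ ≤ mΩ →
      CondIndep (genSig (G k ∪ {A k})) m₁ (genSig (B k)) (hGAle k) P →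
      ∀ f : Ω → ℝ, StronglyMeasurable[m₁] f → Integrable f P →
      (fun ω => (P[f * ind (A k) (a k) | genSig (G k ∪ B k)]) ω /
        (P[ind (A k) (a k) | genSig (G k ∪ B k)]) ω) =ᵐ[P]
      fun ω => (P[f * ind (A k) (a k) | genSig (G k)]) ω /
        (P[ind (A k) (a k) | genSig (G k)]) ω := by
    intro k hk
    have hpos := hGpos.propen_ne_zero hk
    have hpos₂ := hGBpos.propen_ne_zero hk
    simp only [propen, genSig_union] at hpos hpos₂
    intro m₁ h₁ hci f hfm hf
    have hmA : genSig (G k) ⊔ MeasurableSpace.comap (A k) inferInstance ≤ mΩ :=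
      sup_le (hGle k) (hA k).comap_le
    have hci' : CondIndep (genSig (G k) ⊔ MeasurableSpace.comap (A k) inferInstance) m₁
        (genSig (B k)) hmA P := by
      simpa only [genSig_union, genSig_singleton] using hci
    simp only [genSig_union]
    exact condExp_mul_ind_div_eq_of_condIndep (hA k) (a k) h₁ (hBle k) hmA hci' hfm hf
      hpos hpos₂
  have hmain : ∀ n ≤ p, bAux P A a Y (fun i => G i ∪ B i) p n =ᵐ[P] bAux P A a Y G p n := by
    intro n
    induction n with
    | zero =>
      intro _
      obtain ⟨C, hC⟩ := hYbd
      exact hstep p le_rfl _ hYm.comap_le hYB Y (comap_measurable Y).stronglyMeasurable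
        (Integrable.of_bound hYm.aestronglyMeasurable C (ae_of_all _ hC))
    | succ n ih =>
      intro hn
      have hsub : p - n - 1 = p - (n + 1) := by omega
      have hci := hGBk (p - n) (by omega) (Nat.sub_le _ _)
      simp only [hsub] at hci
      refine Filter.EventuallyEq.trans ?_ (hstep (p - (n + 1)) (Nat.sub_le _ _) _ (hGle _) hci
        (bAux P A a Y G p n) (stronglyMeasurable_bAux n) (integrable_bAux hGle hGpos n))
      refine (condExp_congr_ae ?_).div .rfl
      exact (ih (by omega)).mul .rfl
  exact ⟨fun k _ => hmain (p - k) (Nat.sub_le _ _),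
    integral_congr_ae (hmain (p - 0) (Nat.sub_le _ _))⟩
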